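/- Let X be a nonempty compact Hausdorff space and f : X → X a homeomorphism. Then there is no compact proper subset N ⊊ X such that f(N) ⊆ int(N) and the nonwandering set Ω(f) is contained in ⋂_{h≥1} f^h(N). (This is the case n = 1 in the proof of Lemma 1 of the paper: the nonwandering set of a homeomorphism of a compact space cannot be contained in a single attractor whose trapping region is a proper subset.) -/

import Mathlib

/-- The nonwandering set of a map `f`: points `x` such that for every neighborhood `U`
of `x` there are infinitely many positive integers `n` with `f^n(U) ∩ U ≠ ∅`. -/
def nonwanderingSet {X : Type*} [TopologicalSpace X] (f : X → X) : Set X :=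
  {x | ∀ U ∈ nhds x, {n : ℕ | 0 < n ∧ ((f^[n]) '' U ∩ U).Nonempty}.Infinite}

/-- The nonwandering set of a homeomorphism of a nonempty compact Hausdorff space cannot be
contained in `⋂_{h ≥ 1} f^h(N)` for a compact proper subset `N` with `f(N) ⊆ int N`. -/
theorem no_single_attractor {X : Type*} [TopologicalSpace X] [CompactSpace X] [T2Space X]
    [Nonempty X] (f : X ≃ₜ X) :
    ¬ ∃ N : Set X, IsCompact N ∧ N ≠ Set.univ ∧ (⇑f) '' N ⊆ interior N ∧
      nonwanderingSet ⇑f ⊆ ⋂ h ∈ {h : ℕ | 1 ≤ h}, (⇑f)^[h] '' N := by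
  rintro ⟨N, -, hne, hN, hΩ⟩
  obtain ⟨p, hp⟩ := (Set.ne_univ_iff_exists_notMem N).1 hne
  have hfN : ∀ x ∈ N, f x ∈ N := fun x hx => interior_subset (hN ⟨x, hx, rfl⟩)
  have hfun : ∀ n, ∀ x ∈ N, (⇑f)^[n] x ∈ N := by
    intro n
    induction n with
    | zero => exact fun x hx => hx
    | succ k ih =>
        intro x hx
        rw [Function.iterate_succ_apply]
        exact ih _ (hfN x hx)
  have hinv : ∀ k, (⇑f)^[k] ((⇑f.symm)^[k] p) = p := fun k =>
    (Function.LeftInverse.iterate f.apply_symm_apply k) p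
  have hout : ∀ k, (⇑f.symm)^[k] p ∉ N := fun k hk => hp (by
    have := hfun k _ hk
    rwa [hinv] at this)
  obtain ⟨x, hx⟩ := exists_clusterPt_of_compactSpace
    (Filter.map (fun k : ℕ => (⇑f.symm)^[k] p) Filter.atTop)
  have hfreq : ∀ U ∈ nhds x, ∃ᶠ k in Filter.atTop, (⇑f.symm)^[k] p ∈ U :=
    fun U hU => (mapClusterPt_iff_frequently.1 hx) U hU
  have hxΩ : x ∈ nonwanderingSet ⇑f := by
    intro U hU
    have hF := Filter.frequently_atTop.1 (hfreq U hU)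
    obtain ⟨k₀, -, hk₀⟩ := hF 0
    refine Set.infinite_of_not_bddAbove ?_
    rintro ⟨b, hb⟩
    obtain ⟨k, hk, hkU⟩ := hF (k₀ + b + 1)
    have hmem : k - k₀ ∈ {n : ℕ | 0 < n ∧ (((⇑f)^[n]) '' U ∩ U).Nonempty} := by
      refine ⟨by omega, (⇑f.symm)^[k₀] p, ⟨_, hkU, ?_⟩, hk₀⟩
      have hsplit : k = (k - k₀) + k₀ := by omega
      have e : (⇑f.symm)^[k] p = (⇑f.symm)^[k - k₀] ((⇑f.symm)^[k₀] p) := by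
        rw [← Function.iterate_add_apply, ← hsplit]
      rw [e]
      exact (Function.LeftInverse.iterate f.apply_symm_apply (k - k₀)) _
    have := hb hmem
    omega
  have h1 := Set.mem_iInter₂.1 (hΩ hxΩ) 1 (le_refl 1)
  rw [Function.iterate_one] at h1
  obtain ⟨k, hk⟩ := (hfreq _ (isOpen_interior.mem_nhds (hN h1))).exists
  exact hout k (interior_subset hk)
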